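/- If T is a finite tree with at least 2m vertices such that every edge removal yields a component of size less than m, then T has a vertex whose removal leaves components each of size less than m, and moreover such a tree (non-divisible tree) must have a vertex of degree at least 3 when |T| ≥ 2m and m ≥ 2. -/

import Mathlib

theorem aux_reach {V : Type*} (T : SimpleGraph V) (u w : V) :
    ∀ a x : V, (T.deleteEdges {s(w, u)}).Walk a x → ¬ (T.deleteEdges {s(w, u)}).Reachable u a →
      (T.deleteEdges {e : Sym2 V | u ∈ e}).Reachable a x := by
  intro a x p
  induction p with
  | nil => intro _; exact SimpleGraph.Reachable.refl _
  | @cons a b c h p ih =>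
    intro hn
    have hb : ¬ (T.deleteEdges {s(w, u)}).Reachable u b := fun hr => hn (hr.trans h.symm.reachable)
    have hau : u ≠ a := by rintro rfl; exact hn (SimpleGraph.Reachable.refl _)
    have hbu : u ≠ b := by rintro rfl; exact hb (SimpleGraph.Reachable.refl _)
    have hadj : (T.deleteEdges {e : Sym2 V | u ∈ e}).Adj a b := by
      rw [SimpleGraph.deleteEdges_adj] at h ⊢
      refine ⟨h.1, ?_⟩
      simp [hau, hbu]
    exact hadj.reachable.trans (ih hb)

theorem aux_nbr {V : Type*} (T : SimpleGraph V) (u : V) :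
    ∀ z y : V, T.Walk z y → y = u → z ≠ u →
      ∃ w, T.Adj u w ∧ (T.deleteEdges {e : Sym2 V | u ∈ e}).Reachable z w := by
  intro z y p
  induction p with
  | nil => intro h h'; exact absurd h h'
  | @cons a b c h p ih =>
    intro hc ha
    by_cases hb : b = u
    · subst hb
      exact ⟨a, h.symm, SimpleGraph.Reachable.refl _⟩
    · obtain ⟨w, hw, hr⟩ := ih hc hb
      have hadj : (T.deleteEdges {e : Sym2 V | u ∈ e}).Adj a b := by
        rw [SimpleGraph.deleteEdges_adj]
        refine ⟨h, ?_⟩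
        simp [Ne.symm ha, Ne.symm hb]
      exact ⟨w, hw, hadj.reachable.trans hr⟩

theorem stmt_3 {V : Type*} [Fintype V] (T : SimpleGraph V) [DecidableRel T.Adj]
    (hT : T.IsTree) (m : ℕ) (hm : 2 ≤ m) (hcard : 2 * m ≤ Fintype.card V)
    (hnondiv : ∀ u v : V, T.Adj u v →
      Nat.card {x : V // (T.deleteEdges {s(u, v)}).Reachable u x} < m ∨
      Nat.card {x : V // (T.deleteEdges {s(u, v)}).Reachable v x} < m) :
    ∃ v : V,
      (∀ u : V, u ≠ v →
        Nat.card {x : V // (T.deleteEdges {e : Sym2 V | v ∈ e}).Reachable u x} < m) ∧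
      3 ≤ T.degree v := by
  classical
  have hconn : ∀ a b, T.Reachable a b := hT.connected.preconnected
  have hbr : ∀ u w, T.Adj u w → ¬ (T.deleteEdges {s(w, u)}).Reachable u w := by
    intro u w h
    have := SimpleGraph.isAcyclic_iff_forall_adj_isBridge.1 hT.isAcyclic h
    rw [SimpleGraph.isBridge_iff] at this
    rw [Sym2.eq_swap]
    exact this
  -- components
  let S : V → V → Finset V := fun u v =>
    Finset.univ.filter fun x => (T.deleteEdges {s(u, v)}).Reachable u x
  let C : V → V → Finset V := fun u z =>
    Finset.univ.filter fun x => (T.deleteEdges {e : Sym2 V | u ∈ e}).Reachable z x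
  have hC : ∀ u z, Nat.card {x : V // (T.deleteEdges {e : Sym2 V | u ∈ e}).Reachable z x}
      = (C u z).card := by
    intro u z
    rw [Nat.card_eq_fintype_card, Fintype.card_subtype]
  have hS : ∀ u v, Nat.card {x : V // (T.deleteEdges {s(u, v)}).Reachable u x}
      = (S u v).card := by
    intro u v
    rw [Nat.card_eq_fintype_card, Fintype.card_subtype]
  have hnd : ∀ u v, T.Adj u v → (S u v).card < m ∨ (S v u).card < m := by
    intro u v h
    rw [← hS, ← hS, Sym2.eq_swap (a := v) (b := u)]
    exact hnondiv u v h
  have hle : ∀ u v, T.deleteEdges {e : Sym2 V | u ∈ e} ≤ T.deleteEdges {s(u, v)} := by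
    intro u v
    apply SimpleGraph.deleteEdges_anti
    intro e he
    rw [Set.mem_singleton_iff] at he
    subst he
    simp
  have hSC : ∀ u w, T.Adj u w → S w u = C u w := by
    intro u w h
    ext x
    simp only [S, C, Finset.mem_filter, Finset.mem_univ, true_and]
    constructor
    · rintro ⟨p⟩
      exact aux_reach T u w w x p (hbr u w h)
    · intro hr
      have := hr.mono (hle u w)
      rwa [Sym2.eq_swap] at this
  have hcover : ∀ u v, T.Adj u v → Finset.univ ⊆ S u v ∪ S v u := by
    intro u v h x _
    rw [Finset.mem_union]
    by_cases hx : x = u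
    · left; subst hx; simp [S]
    obtain ⟨p⟩ := hconn x u
    obtain ⟨w, hw, hr⟩ := aux_nbr T u x u p rfl hx
    by_cases hwv : w = v
    · right
      rw [hSC u v h]
      subst hwv
      simpa [C] using hr.symm
    · left
      simp only [S, Finset.mem_filter, Finset.mem_univ, true_and]
      have h1 : (T.deleteEdges {s(u, v)}).Adj u w := by
        rw [SimpleGraph.deleteEdges_adj]
        refine ⟨hw, ?_⟩
        simp only [Set.mem_singleton_iff, Sym2.eq_iff]
        rintro (⟨_, h2⟩ | ⟨_, h2⟩)
        · exact hwv h2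
        · exact hw.ne h2.symm
      exact h1.reachable.trans (hr.symm.mono (hle u v))
  -- a heavy dart exists
  have hex : ∃ d : V × V, T.Adj d.1 d.2 ∧ m ≤ (S d.1 d.2).card := by
    have : 1 < Fintype.card V := by omega
    obtain ⟨a, b, hab⟩ := Fintype.exists_pair_of_one_lt_card this
    obtain ⟨p⟩ := hconn b a
    obtain ⟨w, hw, _⟩ := aux_nbr T a b a p rfl hab.symm
    have h1 := (Finset.card_le_card (hcover a w hw)).trans (Finset.card_union_le _ _)
    rw [Finset.card_univ] at h1
    by_cases h2 : m ≤ (S a w).card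
    · exact ⟨(a, w), hw, h2⟩
    · exact ⟨(w, a), hw.symm, by simp only; omega⟩
  obtain ⟨⟨u, v⟩, hd, hmin⟩ := Finset.exists_min_image
    (Finset.univ.filter fun d : V × V => T.Adj d.1 d.2 ∧ m ≤ (S d.1 d.2).card)
    (fun d => (S d.1 d.2).card) (by
      obtain ⟨d, hd⟩ := hex
      exact ⟨d, by simpa using hd⟩)
  simp only [Finset.mem_filter, Finset.mem_univ, true_and] at hd hmin
  obtain ⟨huv, hbig⟩ := hd
  have hlight : ∀ w, T.Adj u w → (C u w).card < m := by
    intro w hw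
    rw [← hSC u w hw]
    by_cases hwv : w = v
    · subst hwv
      rcases hnd u w huv with h | h
      · omega
      · exact h
    by_contra hcon
    have h1 := hmin (w, u) ⟨hw.symm, by simp only; omega⟩
    simp only at h1
    have hss : S w u ⊂ S u v := by
      rw [Finset.ssubset_iff_of_subset]
      · refine ⟨u, by simp [S], ?_⟩
        simp only [S, Finset.mem_filter, Finset.mem_univ, true_and]
        exact fun h => hbr u w hw h.symm
      · rw [hSC u w hw]
        intro x hx
        simp only [S, C, Finset.mem_filter, Finset.mem_univ, true_and] at hx ⊢
        have h1 : (T.deleteEdges {s(u, v)}).Adj u w := by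
          rw [SimpleGraph.deleteEdges_adj]
          refine ⟨hw, ?_⟩
          simp only [Set.mem_singleton_iff, Sym2.eq_iff]
          rintro (⟨_, h2⟩ | ⟨_, h2⟩)
          · exact hwv h2
          · exact hw.ne h2.symm
        exact h1.reachable.trans (hx.mono (hle u v))
    have := Finset.card_lt_card hss
    omega
  refine ⟨u, ?_, ?_⟩
  · intro z hz
    rw [hC]
    obtain ⟨p⟩ := hconn z u
    obtain ⟨w, hw, hr⟩ := aux_nbr T u z u p rfl hz
    refine lt_of_le_of_lt (Finset.card_le_card ?_) (hlight w hw)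
    intro x hx
    simp only [C, Finset.mem_filter, Finset.mem_univ, true_and] at hx ⊢
    exact hr.symm.trans hx
  · have hcov : (Finset.univ : Finset V) ⊆ {u} ∪ (T.neighborFinset u).biUnion (C u) := by
      intro z _
      rw [Finset.mem_union, Finset.mem_singleton, Finset.mem_biUnion]
      by_cases hz : z = u
      · exact Or.inl hz
      right
      obtain ⟨p⟩ := hconn z u
      obtain ⟨w, hw, hr⟩ := aux_nbr T u z u p rfl hz
      exact ⟨w, by simpa using hw, by simpa [C] using hr.symm⟩
    have h1 := (Finset.card_le_card hcov).trans (Finset.card_union_le _ _)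
    have h2 := Finset.card_biUnion_le_card_mul (T.neighborFinset u) (C u) (m - 1) (by
      intro w hw
      have := hlight w (by simpa using hw)
      omega)
    rw [Finset.card_univ, Finset.card_singleton] at h1
    rw [SimpleGraph.card_neighborFinset_eq_degree] at h2
    by_contra hcon
    have h3 : T.degree u * (m - 1) ≤ 2 * (m - 1) := Nat.mul_le_mul_right _ (by omega)
    omega
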